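/- arXiv:2504.06989 — 2 statements merged into one kernel-verified Lean document; each statement's English description precedes it below -/
import Mathlib

section
/- Fix γ ∈ ℂ and y ∈ ℤ. There is r0 ∈ (0,1) such that for every r ∈ (0,r0): for every (x1,x2) ∈ ℤ² and every (a1,a2) ∈ {↑,↓}², the function ψ_t defined in the context satisfies the initial condition ψ_0(x1,x2;a1,a2) = 𝟙[x1=y]·𝟙[x2=y]·ε(a1,a2). -/
/-- Spin index `{↑,↓}`. -/
inductive Spin : Type
  | up : Spin
  | down : Spin
  deriving DecidableEq

/-- `ε(↓,↑) = 1`, `ε(↑,↓) = -1`, `ε(↑,↑) = ε(↓,↓) = 0`. -/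
def epsS : Spin → Spin → ℂ
  | Spin.down, Spin.up => 1
  | Spin.up, Spin.down => -1
  | _, _ => 0

/-- `s(z) = (z - 1/z)/(2i)`. -/
noncomputable def sfun (z : ℂ) : ℂ := (z - z⁻¹) / (2 * Complex.I)

/-- `θ = -(s(z1)-s(z2)+2γ)/(s(z1)-s(z2)-2γ)`. -/
noncomputable def theta (γ z1 z2 : ℂ) : ℂ :=
  -((sfun z1 - sfun z2 + 2 * γ) / (sfun z1 - sfun z2 - 2 * γ))

/-- The two-particle Bethe wave function `φ(x1,x2;a1,a2|z1,z2)`. -/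
noncomputable def phi (γ z1 z2 : ℂ) (x1 x2 : ℤ) (a1 a2 : Spin) : ℂ :=
  if x1 ≤ x2 then
    (1 / 2) * epsS a1 a2 * (z1 ^ x1 * z2 ^ x2 - theta γ z1 z2 * (z2 ^ x1 * z1 ^ x2))
  else
    (1 / 2) * epsS a1 a2 * (z1 ^ x2 * z2 ^ x1 - theta γ z1 z2 * (z1 ^ x1 * z2 ^ x2))

/-- The two-particle Hubbard operator with imaginary interaction `H₂`. -/
noncomputable def Ham2 (γ : ℂ) (ψ : ℤ → ℤ → Spin → Spin → ℂ) (x1 x2 : ℤ) (a1 a2 : Spin) : ℂ :=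
  -(ψ (x1 + 1) x2 a1 a2 + ψ (x1 - 1) x2 a1 a2 + ψ x1 (x2 + 1) a1 a2 + ψ x1 (x2 - 1) a1 a2) +
    4 * Complex.I * γ * ((if x1 = x2 then 1 else 0) - 1) * ψ x1 x2 a1 a2

/-- `E(z1,z2) = -(z1 + 1/z1) - (z2 + 1/z2) - 4iγ`. -/
noncomputable def En (γ z1 z2 : ℂ) : ℂ := -(z1 + z1⁻¹) - (z2 + z2⁻¹) - 4 * Complex.I * γ

/-- `∮_{|z|=ρ} f(z) dz/(2πiz)`: the normalized contour integral over the counterclockwise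
circle of radius `ρ` centered at the origin. -/
noncomputable def cint (ρ : ℝ) (f : ℂ → ℂ) : ℂ :=
  (2 * Real.pi * Complex.I)⁻¹ * (∮ z in C(0, ρ), f z / z)

/-- The contour-integral formula `ψ_t(x1,x2;a1,a2)`. -/
noncomputable def psi (γ : ℂ) (y : ℤ) (r : ℝ) (t : ℝ) (x1 x2 : ℤ) (a1 a2 : Spin) : ℂ :=
  cint r fun z1 => cint 1 fun z2 =>
    (z1 * z2) ^ (-y) * Complex.exp (-Complex.I * En γ z1 z2 * t) * phi γ z1 z2 x1 x2 a1 a2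

/-- The iterated integral of `F` over the torus `{|z1| = r} × {|z2| = 1}` in angular coordinates. -/
noncomputable def torusInt (r : ℝ) (F : ℂ → ℂ → ℂ) : ℂ :=
  ∫ α in (0 : ℝ)..2 * Real.pi, ∫ β in (0 : ℝ)..2 * Real.pi, F (circleMap 0 r α) (circleMap 0 1 β)

/-- Continuity of `F` on the torus `{|z1| = r} × {|z2| = 1}`. -/
def TorusContinuous (r : ℝ) (F : ℂ → ℂ → ℂ) : Prop :=
  Continuous fun p : ℝ × ℝ => F (circleMap 0 r p.1) (circleMap 0 1 p.2)

theorem cint_eq_intervalIntegral {r : ℝ} (hr : 0 < r) (f : ℂ → ℂ) :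
    cint r f = (2 * Real.pi : ℂ)⁻¹ * ∫ α in (0 : ℝ)..2 * Real.pi, f (circleMap 0 r α) := by
  have h : (∮ z in C(0, r), f z / z) =
      Complex.I * ∫ α in (0 : ℝ)..2 * Real.pi, f (circleMap 0 r α) := by
    rw [circleIntegral, ← intervalIntegral.integral_const_mul]
    congr 1
    ext α
    have : circleMap 0 r α ≠ 0 := circleMap_ne_center hr.ne'
    simp only [deriv_circleMap, smul_eq_mul]
    field_simp
  rw [cint, h, mul_inv, mul_assoc, inv_mul_cancel_left₀ Complex.I_ne_zero]

theorem cint_cint_eq_torusInt {r : ℝ} (hr : 0 < r) (F : ℂ → ℂ → ℂ) :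
    (cint r fun z1 => cint 1 fun z2 => F z1 z2) =
      (2 * Real.pi : ℂ)⁻¹ * (2 * Real.pi : ℂ)⁻¹ * torusInt r F := by
  rw [cint_eq_intervalIntegral hr]
  simp only [cint_eq_intervalIntegral one_pos, intervalIntegral.integral_const_mul]
  rw [torusInt, mul_assoc]

theorem integral_circleMap_zpow {r : ℝ} (hr : 0 < r) (n : ℤ) :
    ∫ α in (0 : ℝ)..2 * Real.pi, circleMap 0 r α ^ n =
      if n = 0 then (2 * Real.pi : ℂ) else 0 := by
  split_ifs with hn
  · simp [hn]
  · have h : cint r (fun z => z ^ n) = 0 := by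
      have h0 : (∮ z in C(0, r), z ^ n / z) = ∮ z in C(0, r), (z - 0) ^ (n - 1) := by
        refine circleIntegral.integral_congr hr.le fun z hz => ?_
        have hz0 : z ≠ 0 := by
          rintro rfl
          simp [hr.ne] at hz
        simp [zpow_sub_one₀ hz0, div_eq_mul_inv]
      rw [cint, h0, circleIntegral.integral_sub_zpow_of_ne (by omega), mul_zero]
    rw [cint_eq_intervalIntegral hr] at h
    have hpi : (2 * Real.pi : ℂ)⁻¹ ≠ 0 := by simp [Real.pi_ne_zero]
    exact (mul_eq_zero.mp h).resolve_left hpi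

theorem torusInt_monomial {r : ℝ} (hr : 0 < r) (a b : ℤ) :
    torusInt r (fun z1 z2 => z1 ^ a * z2 ^ b) =
      (if a = 0 then (2 * Real.pi : ℂ) else 0) * (if b = 0 then (2 * Real.pi : ℂ) else 0) := by
  simp only [torusInt, intervalIntegral.integral_const_mul, intervalIntegral.integral_mul_const,
    integral_circleMap_zpow hr, integral_circleMap_zpow one_pos]

theorem torusInt_congr {r : ℝ} (hr : 0 < r) {F G : ℂ → ℂ → ℂ}
    (h : ∀ z1 z2 : ℂ, ‖z1‖ = r → ‖z2‖ = 1 → F z1 z2 = G z1 z2) : torusInt r F = torusInt r G := by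
  simp only [torusInt]
  congr 1; ext α; congr 1; ext β
  exact h _ _ (by simp [abs_of_pos hr]) (by simp)

theorem torusInt_const_mul (r : ℝ) (k : ℂ) (F : ℂ → ℂ → ℂ) :
    torusInt r (fun z1 z2 => k * F z1 z2) = k * torusInt r F := by
  simp only [torusInt, intervalIntegral.integral_const_mul]

theorem torusInt_add {r : ℝ} {F G : ℂ → ℂ → ℂ} (hF : TorusContinuous r F)
    (hG : TorusContinuous r G) :
    torusInt r (fun z1 z2 => F z1 z2 + G z1 z2) = torusInt r F + torusInt r G := by
  have inner : ∀ {H : ℂ → ℂ → ℂ}, TorusContinuous r H → ∀ α : ℝ,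
      IntervalIntegrable (fun β => H (circleMap 0 r α) (circleMap 0 1 β))
        MeasureTheory.volume 0 (2 * Real.pi) := fun hH α =>
    (hH.comp (Continuous.prodMk_right α)).intervalIntegrable _ _
  have outer : ∀ {H : ℂ → ℂ → ℂ}, TorusContinuous r H →
      IntervalIntegrable (fun α => ∫ β in (0 : ℝ)..2 * Real.pi,
        H (circleMap 0 r α) (circleMap 0 1 β)) MeasureTheory.volume 0 (2 * Real.pi) :=
    fun {H} hH => (intervalIntegral.continuous_parametric_intervalIntegral_of_continuous'
      (f := fun α β => H (circleMap 0 r α) (circleMap 0 1 β)) hH 0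
        (2 * Real.pi)).intervalIntegrable _ _
  simp only [torusInt]
  rw [← intervalIntegral.integral_add (outer hF) (outer hG)]
  congr 1; ext α
  exact intervalIntegral.integral_add (inner hF α) (inner hG α)

theorem norm_torusInt_le {r : ℝ} (hr : 0 < r) {F : ℂ → ℂ → ℂ} {C : ℝ}
    (h : ∀ z1 z2 : ℂ, ‖z1‖ = r → ‖z2‖ = 1 → ‖F z1 z2‖ ≤ C) :
    ‖torusInt r F‖ ≤ C * (2 * Real.pi) * (2 * Real.pi) := by
  have hpi : |2 * Real.pi - 0| = 2 * Real.pi := by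
    rw [sub_zero, abs_of_pos Real.two_pi_pos]
  rw [torusInt]
  nth_rewrite 4 [← hpi]
  refine intervalIntegral.norm_integral_le_of_norm_le_const fun α _ => ?_
  nth_rewrite 2 [← hpi]
  exact intervalIntegral.norm_integral_le_of_norm_le_const fun β _ =>
    h _ _ (by simp [abs_of_pos hr]) (by simp)

/-- The polynomial denominator of the Bethe scattering factor after clearing `1 / z1`. -/
noncomputable def betheDenom (c z1 z2 : ℂ) : ℂ := 1 + (z1 * z2 - z1 * z2⁻¹ + c * z1 - z1 ^ 2)

theorem half_le_norm_betheDenom {c z1 z2 : ℂ} {r : ℝ} (hr1 : r ≤ 1)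
    (hr : r * (3 + ‖c‖) ≤ 1 / 2) (h1 : ‖z1‖ = r) (h2 : ‖z2‖ = 1) :
    1 / 2 ≤ ‖betheDenom c z1 z2‖ := by
  have hr0 : 0 ≤ r := h1 ▸ norm_nonneg z1
  have hx : ‖z1 * z2 - z1 * z2⁻¹ + c * z1 - z1 ^ 2‖ ≤ 1 / 2 := by
    calc _ ≤ ‖z1 * z2‖ + ‖z1 * z2⁻¹‖ + ‖c * z1‖ + ‖z1 ^ 2‖ :=
          (norm_sub_le _ _).trans (add_le_add_left ((norm_add_le _ _).trans
            (add_le_add_left (norm_sub_le _ _) _)) _)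
      _ = r + r + ‖c‖ * r + r ^ 2 := by simp [h1, h2]
      _ ≤ 1 / 2 := by nlinarith
  have := norm_sub_le (betheDenom c z1 z2) (z1 * z2 - z1 * z2⁻¹ + c * z1 - z1 ^ 2)
  have h1' : betheDenom c z1 z2 - (z1 * z2 - z1 * z2⁻¹ + c * z1 - z1 ^ 2) = 1 := by
    rw [betheDenom]; ring
  rw [h1', norm_one] at this
  linarith

theorem torusContinuous_monomial {r : ℝ} (hr : 0 < r) (a b : ℤ) :
    TorusContinuous r (fun z1 z2 => z1 ^ a * z2 ^ b) := by
  have h1 : Continuous fun p : ℝ × ℝ => circleMap 0 r p.1 :=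
    (continuous_circleMap 0 r).comp continuous_fst
  have h2 : Continuous fun p : ℝ × ℝ => circleMap 0 1 p.2 :=
    (continuous_circleMap 0 1).comp continuous_snd
  exact (h1.zpow₀ a fun p => Or.inl (circleMap_ne_center hr.ne')).mul
    (h2.zpow₀ b fun p => Or.inl (circleMap_ne_center one_ne_zero))

theorem torusContinuous_monomial_div {c : ℂ} {r : ℝ} (hr0 : 0 < r) (hr1 : r ≤ 1)
    (hr : r * (3 + ‖c‖) ≤ 1 / 2) (a b : ℤ) :
    TorusContinuous r (fun z1 z2 => z1 ^ a * z2 ^ b / betheDenom c z1 z2) := by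
  have h1 : Continuous fun p : ℝ × ℝ => circleMap 0 r p.1 :=
    (continuous_circleMap 0 r).comp continuous_fst
  have h2 : Continuous fun p : ℝ × ℝ => circleMap 0 1 p.2 :=
    (continuous_circleMap 0 1).comp continuous_snd
  have h2' : Continuous fun p : ℝ × ℝ => (circleMap 0 1 p.2)⁻¹ :=
    h2.inv₀ fun p => circleMap_ne_center one_ne_zero
  refine (torusContinuous_monomial hr0 a b).div ?_ fun p => ?_
  · simp only [betheDenom]
    fun_prop
  · have := half_le_norm_betheDenom hr1 hr (z1 := circleMap 0 r p.1) (z2 := circleMap 0 1 p.2)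
      (by simp [abs_of_pos hr0]) (by simp)
    exact norm_pos_iff.mp (by linarith)

theorem TorusContinuous.const_mul {r : ℝ} {F : ℂ → ℂ → ℂ} (hF : TorusContinuous r F) (k : ℂ) :
    TorusContinuous r (fun z1 z2 => k * F z1 z2) :=
  Continuous.mul continuous_const hF

theorem TorusContinuous.add {r : ℝ} {F G : ℂ → ℂ → ℂ} (hF : TorusContinuous r F)
    (hG : TorusContinuous r G) : TorusContinuous r (fun z1 z2 => F z1 z2 + G z1 z2) :=
  Continuous.add hF hG

/-- Multiplying numerator and denominator by `betheDenom` gives a recursion for the torus integrals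
of `z1 ^ a * z2 ^ b / betheDenom`. -/
theorem torusInt_monomial_div_recursion {c : ℂ} {r : ℝ} (hr0 : 0 < r) (hr1 : r ≤ 1)
    (hr : r * (3 + ‖c‖) ≤ 1 / 2) {a b : ℤ} (hab : b < a) :
    torusInt r (fun z1 z2 => z1 ^ a * z2 ^ b / betheDenom c z1 z2) =
      (-1) * torusInt r (fun z1 z2 => z1 ^ (a + 1) * z2 ^ (b + 1) / betheDenom c z1 z2) +
      torusInt r (fun z1 z2 => z1 ^ (a + 1) * z2 ^ (b - 1) / betheDenom c z1 z2) +
      (-c) * torusInt r (fun z1 z2 => z1 ^ (a + 1) * z2 ^ b / betheDenom c z1 z2) +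
      torusInt r (fun z1 z2 => z1 ^ (a + 2) * z2 ^ b / betheDenom c z1 z2) := by
  have hc := torusContinuous_monomial_div hr0 hr1 hr
  have h0 : torusInt r (fun z1 z2 => z1 ^ a * z2 ^ b) = 0 := by
    rw [torusInt_monomial hr0]
    rcases eq_or_ne a 0 with rfl | ha
    · simp [hab.ne]
    · simp [ha]
  have hA := (hc (a + 1) (b + 1)).const_mul (-1)
  have hB := hc (a + 1) (b - 1)
  have hC := (hc (a + 1) b).const_mul (-c)
  have hD := hc (a + 2) b
  rw [← torusInt_const_mul, ← torusInt_const_mul, ← torusInt_add hA hB,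
    ← torusInt_add (hA.add hB) hC, ← torusInt_add ((hA.add hB).add hC) hD, ← zero_add (torusInt r
      fun z1 z2 => _ + _), ← h0,
    ← torusInt_add (torusContinuous_monomial hr0 a b) (((hA.add hB).add hC).add hD)]
  refine torusInt_congr hr0 fun z1 z2 h1 h2 => ?_
  have hz1 : z1 ≠ 0 := norm_pos_iff.mp (h1 ▸ hr0)
  have hz2 : z2 ≠ 0 := norm_pos_iff.mp (h2 ▸ one_pos)
  have hE : betheDenom c z1 z2 ≠ 0 :=
    norm_pos_iff.mp (one_half_pos.trans_le (half_le_norm_betheDenom hr1 hr h1 h2))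
  rw [zpow_add₀ hz1, zpow_add₀ hz1, zpow_add₀ hz2, zpow_sub₀ hz2, zpow_one, zpow_one, zpow_ofNat]
  have key : z1 ^ a * z2 ^ b =
      z1 ^ a * z2 ^ b * betheDenom c z1 z2 / betheDenom c z1 z2 := by
    rw [mul_div_cancel_right₀ _ hE]
  nth_rewrite 2 [key]
  simp only [← mul_div_assoc, ← add_div]
  congr 1
  rw [betheDenom]
  ring

theorem norm_torusInt_monomial_div_le {c : ℂ} {r : ℝ} (hr0 : 0 < r) (hr1 : r ≤ 1)
    (hr : r * (3 + ‖c‖) ≤ 1 / 2) (n : ℕ) {a b : ℤ} (hab : b < a) :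
    ‖torusInt r (fun z1 z2 => z1 ^ a * z2 ^ b / betheDenom c z1 z2)‖ ≤
      2 * (2 * Real.pi) * (2 * Real.pi) * (1 / 2) ^ n * r ^ a := by
  induction n generalizing a b with
  | zero =>
    have h := norm_torusInt_le hr0 (F := fun z1 z2 => z1 ^ a * z2 ^ b / betheDenom c z1 z2)
      (C := 2 * r ^ a) fun z1 z2 h1 h2 => by
        have hE := half_le_norm_betheDenom hr1 hr h1 h2
        rw [norm_div, norm_mul, norm_zpow, norm_zpow, h1, h2, one_zpow, mul_one,
          div_le_iff₀ (by linarith)]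
        nlinarith [zpow_pos hr0 a]
    linarith
  | succ n ih =>
    rw [torusInt_monomial_div_recursion hr0 hr1 hr hab]
    set K : ℝ := 2 * (2 * Real.pi) * (2 * Real.pi) * (1 / 2) ^ n with hK
    have hK0 : 0 ≤ K := by positivity
    have hra := zpow_pos hr0 a
    have e1 : r ^ (a + 1) = r * r ^ a := by rw [zpow_add_one₀ hr0.ne', mul_comm]
    have e2 : r ^ (a + 2) = r ^ 2 * r ^ a := by rw [zpow_add₀ hr0.ne', mul_comm]; norm_cast
    have i1 := ih (a := a + 1) (b := b + 1) (by omega)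
    have i2 := ih (a := a + 1) (b := b - 1) (by omega)
    have i3 := ih (a := a + 1) (b := b) (by omega)
    have i4 := ih (a := a + 2) (b := b) (by omega)
    refine (norm_add₄_le).trans ?_
    rw [norm_mul, norm_mul, norm_neg, norm_neg, norm_one, one_mul]
    have i3' := mul_le_mul_of_nonneg_left i3 (norm_nonneg c)
    rw [e1] at i1 i2 i3'
    rw [e2] at i4
    have hrr : r * 2 + ‖c‖ * r + r ^ 2 ≤ 1 / 2 := by nlinarith
    have := mul_le_mul_of_nonneg_left hrr (mul_nonneg hK0 hra.le)
    rw [pow_succ, ← mul_assoc, ← hK]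
    linarith

theorem torusInt_monomial_div_eq_zero {c : ℂ} {r : ℝ} (hr0 : 0 < r) (hr1 : r ≤ 1)
    (hr : r * (3 + ‖c‖) ≤ 1 / 2) {a b : ℤ} (hab : b < a) :
    torusInt r (fun z1 z2 => z1 ^ a * z2 ^ b / betheDenom c z1 z2) = 0 := by
  have hlim := ((tendsto_pow_atTop_nhds_zero_of_lt_one (r := (1 / 2 : ℝ)) (by norm_num)
    (by norm_num)).const_mul (2 * (2 * Real.pi) * (2 * Real.pi))).mul_const (r ^ a)
  rw [mul_zero, zero_mul] at hlim
  exact norm_le_zero_iff.mp (ge_of_tendsto' hlim fun n =>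
    norm_torusInt_monomial_div_le hr0 hr1 hr n hab)

theorem neg_theta_eq {γ z1 z2 : ℂ} (hz1 : z1 ≠ 0)
    (hE : betheDenom (4 * Complex.I * γ) z1 z2 ≠ 0) :
    -theta γ z1 z2 = 1 + -(8 * Complex.I * γ) * (z1 / betheDenom (4 * Complex.I * γ) z1 z2) := by
  have hs : sfun z1 - sfun z2 - 2 * γ =
      -betheDenom (4 * Complex.I * γ) z1 z2 / (2 * Complex.I * z1) := by
    rw [sfun, sfun, betheDenom, eq_div_iff (by simp [hz1])]
    field_simp
    ring
  have hn : sfun z1 - sfun z2 + 2 * γ = (sfun z1 - sfun z2 - 2 * γ) + 4 * γ := by ring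
  have hI := Complex.I_ne_zero
  rw [theta, hn, hs, neg_neg]
  field_simp
  ring

/-- The initial amplitude for ordered positions `m ≤ M`. -/
theorem torusInt_bethe {γ : ℂ} {r : ℝ} (hr0 : 0 < r) (hr1 : r ≤ 1)
    (hr : r * (3 + ‖4 * Complex.I * γ‖) ≤ 1 / 2) (k : ℂ) (y : ℤ) {m M : ℤ} (hm : m ≤ M) :
    torusInt r (fun z1 z2 => (z1 * z2) ^ (-y) *
      (1 / 2 * k * (z1 ^ m * z2 ^ M - theta γ z1 z2 * (z2 ^ m * z1 ^ M)))) =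
      (2 * Real.pi) * (2 * Real.pi) *
        ((if m = y then 1 else 0) * (if M = y then 1 else 0) * k) := by
  have hA := torusContinuous_monomial hr0 (m - y) (M - y)
  have hB := torusContinuous_monomial hr0 (M - y) (m - y)
  have hC := (torusContinuous_monomial_div hr0 hr1 hr (M - y + 1) (m - y)).const_mul
    (-(8 * Complex.I * γ))
  have h : torusInt r (fun z1 z2 => (z1 * z2) ^ (-y) *
      (1 / 2 * k * (z1 ^ m * z2 ^ M - theta γ z1 z2 * (z2 ^ m * z1 ^ M)))) =
      torusInt r (fun z1 z2 => 1 / 2 * k * (z1 ^ (m - y) * z2 ^ (M - y) +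
        z1 ^ (M - y) * z2 ^ (m - y) + -(8 * Complex.I * γ) * (z1 ^ (M - y + 1) * z2 ^ (m - y) /
          betheDenom (4 * Complex.I * γ) z1 z2))) := by
    refine torusInt_congr hr0 fun z1 z2 h1 h2 => ?_
    have hz1 : z1 ≠ 0 := norm_pos_iff.mp (h1 ▸ hr0)
    have hz2 : z2 ≠ 0 := norm_pos_iff.mp (h2 ▸ one_pos)
    have hE : betheDenom (4 * Complex.I * γ) z1 z2 ≠ 0 :=
      norm_pos_iff.mp (one_half_pos.trans_le (half_le_norm_betheDenom hr1 hr h1 h2))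
    rw [sub_eq_add_neg, ← neg_mul, neg_theta_eq hz1 hE, mul_zpow, zpow_add_one₀ hz1]
    simp only [sub_eq_add_neg _ y, zpow_add₀ hz1, zpow_add₀ hz2]
    ring
  rw [h, torusInt_const_mul, torusInt_add (hA.add hB) hC, torusInt_add hA hB, torusInt_const_mul,
    torusInt_monomial_div_eq_zero hr0 hr1 hr (by omega), torusInt_monomial hr0,
    torusInt_monomial hr0]
  simp only [sub_eq_zero]
  split_ifs <;> ring

/-- For fixed `γ ∈ ℂ`, `y ∈ ℤ` and small enough contour radius, `ψ` satisfies the initial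
condition `ψ_0(x1,x2;a1,a2) = 𝟙[x1=y]·𝟙[x2=y]·ε(a1,a2)`. -/
theorem psi_initial_condition (γ : ℂ) (y : ℤ) :
    ∃ r0 ∈ Set.Ioo (0 : ℝ) 1, ∀ r ∈ Set.Ioo (0 : ℝ) r0,
      ∀ (x1 x2 : ℤ) (a1 a2 : Spin),
        psi γ y r 0 x1 x2 a1 a2 =
          (if x1 = y then 1 else 0) * (if x2 = y then 1 else 0) * epsS a1 a2 := by
  refine ⟨1 / (6 + 8 * ‖γ‖), ⟨by positivity, ?_⟩, fun r hr x1 x2 a1 a2 => ?_⟩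
  · rw [div_lt_one (by positivity)]
    linarith [norm_nonneg γ]
  have hr0 : 0 < r := hr.1
  have hlt : r * (6 + 8 * ‖γ‖) < 1 := (lt_div_iff₀ (by positivity)).mp hr.2
  have hrc : r * (3 + ‖4 * Complex.I * γ‖) ≤ 1 / 2 := by
    rw [norm_mul, norm_mul, Complex.norm_I, Complex.norm_ofNat]
    linarith
  have hr1 : r ≤ 1 := by nlinarith [norm_nonneg γ]
  have hpi : (2 * Real.pi : ℂ) ≠ 0 := by simp [Real.pi_ne_zero]
  rw [psi, cint_cint_eq_torusInt hr0]
  simp only [Complex.ofReal_zero, mul_zero, Complex.exp_zero, mul_one, phi]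
  rw [← mul_inv, inv_mul_eq_iff_eq_mul₀ (mul_ne_zero hpi hpi)]
  by_cases h : x1 ≤ x2
  · simp only [if_pos h]
    exact torusInt_bethe hr0 hr1 hrc (epsS a1 a2) y h
  · simp only [if_neg h]
    rw [mul_comm (if x1 = y then (1 : ℂ) else 0),
      ← torusInt_bethe hr0 hr1 hrc (epsS a1 a2) y (not_le.mp h).le]
    exact torusInt_congr hr0 fun z1 z2 _ _ => by ring
end

section
/- Let γ ∈ ℂ and t ∈ ℝ. There is r0 ∈ (0,1) such that for every r ∈ (0,r0), every y ∈ ℤ, and all integers x1 ≤ x2: ∮_{|z1|=r} ∮_{|z2|=1} e^{−iE(z1,z2)t} (z1z2)^{−y} [ z1^{x1}z2^{x2} + ((s(z1)−s(z2)+2γ)/(s(z1)−s(z2)−2γ))·z2^{x1}z1^{x2} ] dz2/(2πiz2) dz1/(2πiz1) = 2·∮_{|z1|=r} ∮_{|z2|=1} e^{−iE(z1,z2)t} (z1z2)^{−y} · z2^{x1}z1^{x2} · (s(z1)−s(z2))/(s(z1)−s(z2)−2γ) dz2/(2πiz2) dz1/(2πiz1). -/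
/-- The one-particle factor `exp(i (z + 1/z) t) z^(-y) z^n` of the free propagator. -/
noncomputable def planeWave (t : ℝ) (y n : ℤ) (z : ℂ) : ℂ :=
  Complex.exp (Complex.I * (z + z⁻¹) * t) * z ^ (-y) * z ^ n

lemma differentiableAt_planeWave (t : ℝ) (y n : ℤ) {z : ℂ} (hz : z ≠ 0) :
    DifferentiableAt ℂ (planeWave t y n) z := by
  unfold planeWave
  have h1 : DifferentiableAt ℂ (fun z : ℂ => z⁻¹) z := differentiableAt_inv hz
  have h2 (m : ℤ) : DifferentiableAt ℂ (fun z : ℂ => z ^ m) z :=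
    differentiableAt_zpow.2 (Or.inl hz)
  have h3 : DifferentiableAt ℂ (fun z : ℂ => Complex.exp (Complex.I * (z + z⁻¹) * t)) z := by
    fun_prop
  exact (h3.mul (h2 _)).mul (h2 _)

lemma ne_zero_of_mem_sphere_zero {R : ℝ} (hR : 0 < R) {z : ℂ} (hz : z ∈ Metric.sphere (0 : ℂ) R) :
    z ≠ 0 := Metric.ne_of_mem_sphere hz hR.ne'

lemma continuousOn_planeWave (t : ℝ) (y n : ℤ) {R : ℝ} (hR : 0 < R) :
    ContinuousOn (planeWave t y n) (Metric.sphere 0 R) := fun _ hz =>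
  (differentiableAt_planeWave t y n
    (ne_zero_of_mem_sphere_zero hR hz)).continuousAt.continuousWithinAt

lemma cint_congr {R : ℝ} (hR : 0 ≤ R) {f g : ℂ → ℂ} (h : Set.EqOn f g (Metric.sphere 0 R)) :
    cint R f = cint R g := by
  unfold cint
  congr 1
  exact circleIntegral.integral_congr hR fun z hz => by simp only [h hz]

lemma cint_const_mul (R : ℝ) (a : ℂ) (f : ℂ → ℂ) :
    cint R (fun z => a * f z) = a * cint R f := by
  unfold cint
  simp only [mul_div_assoc, circleIntegral.integral_const_mul]
  ring

lemma circleIntegrable_div {R : ℝ} (hR : 0 < R) {f : ℂ → ℂ}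
    (hf : ContinuousOn f (Metric.sphere 0 R)) : CircleIntegrable (fun z => f z / z) 0 R :=
  (hf.div continuousOn_id fun _ hz => ne_zero_of_mem_sphere_zero hR hz).circleIntegrable hR.le

lemma cint_add {R : ℝ} (hR : 0 < R) {f g : ℂ → ℂ} (hf : ContinuousOn f (Metric.sphere 0 R))
    (hg : ContinuousOn g (Metric.sphere 0 R)) :
    cint R (fun z => f z + g z) = cint R f + cint R g := by
  unfold cint
  simp only [add_div]
  rw [circleIntegral.integral_add (circleIntegrable_div hR hf) (circleIntegrable_div hR hg),
    mul_add]

lemma cint_sub {R : ℝ} (hR : 0 < R) {f g : ℂ → ℂ} (hf : ContinuousOn f (Metric.sphere 0 R))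
    (hg : ContinuousOn g (Metric.sphere 0 R)) :
    cint R (fun z => f z - g z) = cint R f - cint R g := by
  unfold cint
  simp only [sub_div]
  rw [circleIntegral.integral_sub (circleIntegrable_div hR hf) (circleIntegrable_div hR hg),
    mul_sub]

/-- Adding a continuous function of zero integral does not change the integral, whether or not
the other summand is integrable. -/
lemma cint_add_of_cint_eq_zero {R : ℝ} (hR : 0 < R) {f g : ℂ → ℂ}
    (hg : ContinuousOn g (Metric.sphere 0 R)) (h0 : cint R g = 0) :
    cint R (fun z => f z + g z) = cint R f := by
  have hg' := circleIntegrable_div hR hg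
  by_cases hf : CircleIntegrable (fun z => f z / z) 0 R
  · have h : cint R (fun z => f z + g z) = cint R f + cint R g := by
      unfold cint
      simp only [add_div]
      rw [circleIntegral.integral_add hf hg', mul_add]
    rw [h, h0, add_zero]
  · unfold cint
    rw [circleIntegral.integral_undef hf, circleIntegral.integral_undef]
    intro h
    have h' := h.sub hg'
    simp only [Pi.sub_def, ← sub_div, add_sub_cancel_right] at h'
    exact hf h'

lemma cint_planeWave_eq (t : ℝ) (y n : ℤ) {r R : ℝ} (hr : 0 < r) (hrR : r ≤ R) :
    cint R (planeWave t y n) = cint r (planeWave t y n) := by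
  unfold cint
  congr 1
  have hd : ∀ z : ℂ, z ∉ Metric.ball (0 : ℂ) r →
      DifferentiableAt ℂ (fun z => planeWave t y n z / z) z := by
    intro z hz
    have hz0 : z ≠ 0 := by
      rintro rfl
      exact hz (Metric.mem_ball_self hr)
    exact (differentiableAt_planeWave t y n hz0).div differentiableAt_id hz0
  refine Complex.circleIntegral_eq_of_differentiable_on_annulus_off_countable hr hrR
    Set.countable_empty (fun z hz => (hd z hz.2).continuousAt.continuousWithinAt) ?_
  rintro z ⟨⟨_, hz⟩, _⟩
  exact hd z fun h => hz (Metric.ball_subset_closedBall h)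

lemma exp_En_mul_zpow (γ : ℂ) (t : ℝ) (y m n : ℤ) (z1 z2 : ℂ) :
    Complex.exp (-Complex.I * En γ z1 z2 * t) * (z1 * z2) ^ (-y) * (z1 ^ m * z2 ^ n) =
      Complex.exp (-4 * γ * t) * (planeWave t y m z1 * planeWave t y n z2) := by
  have h : -Complex.I * En γ z1 z2 * t =
      -4 * γ * t + (Complex.I * (z1 + z1⁻¹) * t + Complex.I * (z2 + z2⁻¹) * t) := by
    unfold En
    linear_combination (4 * γ * t) * Complex.I_sq
  rw [h, Complex.exp_add, Complex.exp_add, mul_zpow]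
  unfold planeWave
  ring

lemma sfun_sub_ne {γ z1 z2 : ℂ} (h1 : 0 < ‖z1‖) (h1' : ‖z1‖ < (4 + 4 * ‖γ‖)⁻¹) (h2 : ‖z2‖ = 1) :
    sfun z1 - sfun z2 - 2 * γ ≠ 0 := by
  intro h
  have hγ := norm_nonneg γ
  have hinv : 4 + 4 * ‖γ‖ < ‖z1‖⁻¹ := (lt_inv_comm₀ h1 (by positivity)).1 h1'
  have hle : ‖z1‖ < 1 := h1'.trans_le (inv_le_one_of_one_le₀ (by linarith))
  have key : z1⁻¹ = z1 - (z2 - z2⁻¹) - 4 * Complex.I * γ := by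
    unfold sfun at h
    have hI := Complex.I_ne_zero
    generalize z1⁻¹ = a, z2⁻¹ = b at h ⊢
    field_simp at h
    linear_combination -h
  have : ‖z1⁻¹‖ ≤ ‖z1‖ + (‖z2‖ + ‖z2⁻¹‖) + 4 * ‖γ‖ := by
    rw [key]
    refine (norm_sub_le _ _).trans (add_le_add ((norm_sub_le _ _).trans
      (add_le_add le_rfl (norm_sub_le _ _))) ?_)
    simp
  rw [norm_inv, norm_inv, h2] at this
  norm_num at this
  linarith

/-- Combining the identity and the transposed term: for ordered positions `x1 ≤ x2`,
the sum of the direct and scattered pieces reduces to twice a single bound-type integrand. -/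
theorem two_term_reduction (γ : ℂ) (t : ℝ) :
    ∃ r0 ∈ Set.Ioo (0 : ℝ) 1, ∀ r ∈ Set.Ioo (0 : ℝ) r0, ∀ (y x1 x2 : ℤ), x1 ≤ x2 →
      (cint r fun z1 => cint 1 fun z2 =>
        Complex.exp (-Complex.I * En γ z1 z2 * t) * (z1 * z2) ^ (-y) *
          (z1 ^ x1 * z2 ^ x2 +
            ((sfun z1 - sfun z2 + 2 * γ) / (sfun z1 - sfun z2 - 2 * γ)) *
              (z2 ^ x1 * z1 ^ x2))) =
      2 * (cint r fun z1 => cint 1 fun z2 =>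
        Complex.exp (-Complex.I * En γ z1 z2 * t) * (z1 * z2) ^ (-y) *
          (z2 ^ x1 * z1 ^ x2) *
          ((sfun z1 - sfun z2) / (sfun z1 - sfun z2 - 2 * γ))) := by
  refine ⟨(4 + 4 * ‖γ‖)⁻¹, ⟨by positivity, inv_lt_one_of_one_lt₀ (by
    linarith [norm_nonneg γ])⟩, ?_⟩
  rintro r ⟨hr, hr0⟩ y x1 x2 -
  have hr1 : r ≤ 1 := hr0.le.trans (inv_le_one_of_one_le₀ (by linarith [norm_nonneg γ]))
  set c := Complex.exp (-4 * γ * t)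
  set P := planeWave t y x1
  set Q := planeWave t y x2
  have hP1 : ContinuousOn P (Metric.sphere 0 1) := continuousOn_planeWave t y x1 one_pos
  have hQ1 : ContinuousOn Q (Metric.sphere 0 1) := continuousOn_planeWave t y x2 one_pos
  have hPr : ContinuousOn P (Metric.sphere 0 r) := continuousOn_planeWave t y x1 hr
  have hQr : ContinuousOn Q (Metric.sphere 0 r) := continuousOn_planeWave t y x2 hr
  have hs : ContinuousOn sfun (Metric.sphere 0 1) := by
    unfold sfun
    exact (continuousOn_id.sub (continuousOn_id.inv₀ fun z hz =>
      ne_zero_of_mem_sphere_zero one_pos hz)).div_const _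
  have hzero : cint r (fun z => c * (P z * cint 1 Q - Q z * cint 1 P)) = 0 := by
    have hPi : cint 1 P = cint r P := cint_planeWave_eq t y x1 hr hr1
    have hQi : cint 1 Q = cint r Q := cint_planeWave_eq t y x2 hr hr1
    simp only [mul_comm (P _), mul_comm (Q _)]
    rw [cint_const_mul, cint_sub hr (by fun_prop) (by fun_prop), cint_const_mul, cint_const_mul,
      hPi, hQi]
    ring
  rw [← cint_const_mul]
  refine Eq.trans ?_ (cint_add_of_cint_eq_zero hr (by fun_prop) hzero)
  refine cint_congr hr.le fun z1 hz1 => ?_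
  have hz1' : ‖z1‖ = r := by simpa using hz1
  have hne : ∀ z2 ∈ Metric.sphere (0 : ℂ) 1, sfun z1 - sfun z2 - 2 * γ ≠ 0 := fun z2 hz2 =>
    sfun_sub_ne (hz1' ▸ hr) (hz1' ▸ hr0) (by simpa using hz2)
  have hexp (m n : ℤ) (z2 : ℂ) := exp_En_mul_zpow γ t y m n z1 z2
  have hR (z2 : ℂ) : Complex.exp (-Complex.I * En γ z1 z2 * t) * (z1 * z2) ^ (-y) *
      (z2 ^ x1 * z1 ^ x2) = c * (Q z1 * P z2) := by
    rw [mul_comm (z2 ^ x1), hexp]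
  simp only [mul_add, mul_left_comm _ (_ / _), hexp, hR]
  have hcont : ContinuousOn (fun z2 => c * (Q z1 * P z2) *
      ((sfun z1 - sfun z2) / (sfun z1 - sfun z2 - 2 * γ))) (Metric.sphere 0 1) := by
    refine ContinuousOn.mul (by fun_prop) (ContinuousOn.div (by fun_prop) (by fun_prop) hne)
  calc _ = cint 1 (fun z2 => 2 * (c * (Q z1 * P z2) *
        ((sfun z1 - sfun z2) / (sfun z1 - sfun z2 - 2 * γ))) +
        ((c * P z1) * Q z2 - (c * Q z1) * P z2)) := by
        refine cint_congr zero_le_one fun z2 hz2 => ?_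
        have := hne z2 hz2
        change c * (P z1 * Q z2) + _ = _
        field_simp
        ring
    _ = _ := by
        rw [cint_add one_pos (by fun_prop) (by fun_prop), cint_sub one_pos (by fun_prop)
          (by fun_prop), cint_const_mul, cint_const_mul, cint_const_mul]
        congr 1
        ring
end
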